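/- Assume λ > 0, v₀ ∈ ℝ, and μ satisfies (aa) (assumption (f1) is NOT needed). Let v(t) = v₀ (λ/π) ∫₀^∞ (e^{−rt}/r) G(r) dr. Then v is continuous on [0,∞), infinitely differentiable on (0,∞) with v′(t) = −v₀ (λ/π) ∫₀^∞ e^{−rt} G(r) dr for t > 0, and ∫₀^∞ |v′(t)| dt = |v₀| (λ/π) ∫₀^∞ G(r)/r dr < ∞; in particular v is absolutely continuous on [0,∞). -/

import Mathlib

open MeasureTheory Set Real

/-- The function `G(r)` from formula (g1). -/
noncomputable def Gfun (μ : ℝ → ℝ) (lam : ℝ) (r : ℝ) : ℝ :=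
  (∫ α in Ioo (0:ℝ) 1, r ^ α * Real.sin (π * α) * μ α) /
    ((lam + ∫ α in Ioo (0:ℝ) 1, r ^ α * Real.cos (π * α) * μ α) ^ 2 +
      (∫ α in Ioo (0:ℝ) 1, r ^ α * Real.sin (π * α) * μ α) ^ 2)

/-- The function `v` from formula (postacv). -/
noncomputable def vfun (μ : ℝ → ℝ) (lam v₀ : ℝ) (t : ℝ) : ℝ :=
  v₀ * (lam / π) * ∫ r in Ioi (0:ℝ), (Real.exp (-r * t) / r) * Gfun μ lam r

/-- The integral `∫₀¹ e^{αw} μ(α) dα`, i.e. the symbol `∫₀¹ z^α μ(α) dα` at `z = e^w`. -/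
noncomputable def expSymbol (μ : ℝ → ℝ) (w : ℂ) : ℂ :=
  ∫ α in Ioo (0:ℝ) 1, Complex.exp (α * w) * (μ α : ℂ)

lemma norm_cexp_mul_ofReal (α m : ℝ) (w : ℂ) (hm : 0 ≤ m) :
    ‖Complex.exp (α * w) * (m : ℂ)‖ = Real.exp (α * w.re) * m := by
  simp [Complex.norm_exp, abs_of_nonneg hm]

section
variable {μ : ℝ → ℝ}

lemma integrableOn_exp_mul (hint : IntegrableOn μ (Ioo 0 1)) (x : ℝ) :
    IntegrableOn (fun α => Real.exp (α * x) * μ α) (Ioo 0 1) := by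
  refine Integrable.bdd_mul (c := Real.exp |x|) hint (by fun_prop) ?_
  refine (ae_restrict_iff' measurableSet_Ioo).2 (.of_forall fun α hα => ?_)
  rw [Real.norm_eq_abs, Real.abs_exp, Real.exp_le_exp]
  exact (le_abs_self _).trans (by
    rw [abs_mul, abs_of_pos hα.1]; exact mul_le_of_le_one_left (abs_nonneg _) hα.2.le)

lemma integrableOn_cexp_mul (hmeas : Measurable μ) (hint : IntegrableOn μ (Ioo 0 1)) (w : ℂ) :
    IntegrableOn (fun α : ℝ => Complex.exp (α * w) * (μ α : ℂ)) (Ioo 0 1) := by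
  refine Integrable.mono (integrableOn_exp_mul hint w.re) (by fun_prop) (.of_forall fun α => ?_)
  simp [Complex.norm_exp]

lemma differentiable_expSymbol (hmeas : Measurable μ) (hint : IntegrableOn μ (Ioo 0 1)) :
    Differentiable ℂ (expSymbol μ) := by
  intro w
  refine (hasDerivAt_integral_of_dominated_loc_of_deriv_le (Metric.ball_mem_nhds w one_pos)
    (F := fun (w : ℂ) (α : ℝ) => Complex.exp (α * w) * (μ α : ℂ))
    (F' := fun (w : ℂ) (α : ℝ) => Complex.exp (α * w) * α * (μ α : ℂ))
    (bound := fun α => Real.exp (‖w‖ + 1) * |μ α|)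
    (.of_forall fun z => by fun_prop) (integrableOn_cexp_mul hmeas hint w) (by fun_prop) ?_
    (hint.abs.const_mul _) ?_).2.differentiableAt
  · refine (ae_restrict_iff' measurableSet_Ioo).2 (.of_forall fun α hα z hz => ?_)
    rw [norm_mul, norm_mul, Complex.norm_exp, Complex.norm_real, Complex.norm_real,
      Real.norm_eq_abs, Real.norm_eq_abs, abs_of_pos hα.1]
    gcongr
    refine (mul_le_of_le_one_right (Real.exp_nonneg _) hα.2.le).trans (Real.exp_le_exp.2 ?_)
    rw [Metric.mem_ball, dist_eq_norm] at hz
    have h1 : z.re ≤ ‖w‖ + 1 := by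
      linarith [Complex.re_le_norm z, norm_le_norm_add_norm_sub' z w]
    rw [Complex.re_ofReal_mul]
    nlinarith [norm_nonneg w, hα.1, hα.2]
  · refine .of_forall fun α z _ => ?_
    have h := ((hasDerivAt_id z).const_mul (α : ℂ)).cexp.mul_const (μ α : ℂ)
    simpa using h

lemma norm_expSymbol_le (hnn : ∀ α ∈ Icc (0:ℝ) 1, 0 ≤ μ α) (w : ℂ) :
    ‖expSymbol μ w‖ ≤ ∫ α in Ioo (0:ℝ) 1, Real.exp (α * w.re) * μ α := by
  refine (norm_integral_le_integral_norm _).trans_eq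
    (setIntegral_congr_fun measurableSet_Ioo fun α hα => ?_)
  exact norm_cexp_mul_ofReal α _ w (hnn α (Ioo_subset_Icc_self hα))

open Filter Topology in
lemma tendsto_integral_exp_mul_atBot (hmeas : Measurable μ) (hint : IntegrableOn μ (Ioo 0 1)) :
    Tendsto (fun x => ∫ α in Ioo (0:ℝ) 1, Real.exp (α * x) * μ α) atBot (𝓝 0) := by
  suffices h : Tendsto (fun x => ∫ α in Ioo (0:ℝ) 1, Real.exp (α * x) * μ α) atBot
      (𝓝 (∫ α in Ioo (0:ℝ) 1, (0:ℝ))) by simpa using h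
  refine tendsto_integral_filter_of_dominated_convergence (fun α => |μ α|)
    (.of_forall fun x => by fun_prop) ?_ hint.abs ?_
  · filter_upwards [eventually_le_atBot 0] with x hx
    refine (ae_restrict_iff' measurableSet_Ioo).2 (.of_forall fun α hα => ?_)
    rw [norm_mul, Real.norm_eq_abs, Real.abs_exp]
    exact mul_le_of_le_one_left (abs_nonneg _)
      (Real.exp_le_one_iff.2 (mul_nonpos_of_nonneg_of_nonpos hα.1.le hx))
  · refine (ae_restrict_iff' measurableSet_Ioo).2 (.of_forall fun α hα => ?_)
    simpa using (Real.tendsto_exp_atBot.comp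
      (tendsto_id.const_mul_atBot hα.1)).mul_const (μ α)

lemma sin_pi_mul_le_cos {α y : ℝ} (hα : α ∈ Ioo (0:ℝ) 1) (hy : y ∈ Icc 0 π) :
    Real.sin (π * α) ≤ Real.cos ((α - 1 / 2) * y) := by
  rw [show Real.sin (π * α) = Real.cos ((α - 1 / 2) * π) by
    rw [← Real.cos_sub_pi_div_two]; ring_nf, ← Real.cos_abs ((α - 1 / 2) * y),
    ← Real.cos_abs ((α - 1 / 2) * π), abs_mul, abs_mul, abs_of_nonneg hy.1, abs_of_pos pi_pos]
  have h : |α - 1 / 2| ≤ 1 := abs_le.2 ⟨by linarith [hα.1], by linarith [hα.2]⟩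
  exact Real.cos_le_cos_of_nonneg_of_le_pi (by have := hy.1; positivity)
    (mul_le_of_le_one_left pi_pos.le h) (by gcongr; exact hy.2)

lemma integrableOn_exp_mul_sin (hmeas : Measurable μ) (hint : IntegrableOn μ (Ioo 0 1)) (x : ℝ) :
    IntegrableOn (fun α => Real.exp (α * x) * Real.sin (π * α) * μ α) (Ioo 0 1) := by
  refine Integrable.mono (integrableOn_exp_mul hint x) (by fun_prop) (.of_forall fun α => ?_)
  simp only [norm_mul, Real.norm_eq_abs, Real.abs_exp]
  gcongr
  exact mul_le_of_le_one_right (Real.exp_nonneg _) (Real.abs_sin_le_one _)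

/-- Rotating by `e^{-iy/2}` moves all of `λ` and `e^{αw}`, `0 < α < 1`, into the right half-plane. -/
lemma integral_exp_mul_sin_le_norm {lam : ℝ} (hlam : 0 < lam) (hmeas : Measurable μ)
    (hnn : ∀ α ∈ Icc (0:ℝ) 1, 0 ≤ μ α) (hint : IntegrableOn μ (Ioo 0 1))
    {w : ℂ} (hw : w.im ∈ Icc 0 π) :
    ∫ α in Ioo (0:ℝ) 1, Real.exp (α * w.re) * Real.sin (π * α) * μ α ≤
      ‖(lam : ℂ) + expSymbol μ w‖ := by
  set c : ℂ := Complex.exp (((-(w.im / 2) : ℝ) : ℂ) * Complex.I) with hc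
  have hcn : ‖c‖ = 1 := Complex.norm_exp_ofReal_mul_I _
  have hi := (integrableOn_cexp_mul hmeas hint w).mul_const c
  have hre : (expSymbol μ w * c).re =
      ∫ α in Ioo (0:ℝ) 1, Real.exp (α * w.re) * Real.cos ((α - 1 / 2) * w.im) * μ α := by
    rw [expSymbol, ← integral_mul_const, ← RCLike.re_eq_complex_re, ← integral_re hi]
    refine integral_congr_ae (.of_forall fun α => ?_)
    simp only [RCLike.re_eq_complex_re]
    rw [mul_right_comm, hc, ← Complex.exp_add, Complex.re_mul_ofReal, Complex.exp_re]
    simp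
    left
    ring_nf
  have hi' : IntegrableOn
      (fun α => Real.exp (α * w.re) * Real.cos ((α - 1 / 2) * w.im) * μ α) (Ioo 0 1) := by
    refine Integrable.mono (integrableOn_exp_mul hint w.re) (by fun_prop) (.of_forall fun α => ?_)
    simp only [norm_mul, Real.norm_eq_abs, Real.abs_exp]
    gcongr
    exact mul_le_of_le_one_right (Real.exp_nonneg _) (Real.abs_cos_le_one _)
  have hcre : 0 ≤ c.re := by
    rw [hc, Complex.exp_ofReal_mul_I_re, Real.cos_neg]
    exact Real.cos_nonneg_of_neg_pi_div_two_le_of_le (by linarith [hw.1, pi_pos])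
      (by linarith [hw.2])
  calc _ ≤ (expSymbol μ w * c).re := by
        rw [hre]
        refine setIntegral_mono_on (integrableOn_exp_mul_sin hmeas hint _) hi' measurableSet_Ioo
          fun α hα => ?_
        have := hnn α (Ioo_subset_Icc_self hα)
        gcongr
        exact sin_pi_mul_le_cos hα hw
    _ ≤ (((lam : ℂ) + expSymbol μ w) * c).re := by
        rw [add_mul, Complex.add_re, Complex.re_ofReal_mul]
        exact le_add_of_nonneg_left (mul_nonneg hlam.le hcre)
    _ ≤ ‖((lam : ℂ) + expSymbol μ w) * c‖ := Complex.re_le_norm _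
    _ = _ := by rw [norm_mul, hcn, mul_one]

lemma integral_exp_mul_sin_pos (hmeas : Measurable μ)
    (hnn : ∀ α ∈ Icc (0:ℝ) 1, 0 ≤ μ α) (hint : IntegrableOn μ (Ioo 0 1))
    (hpos : 0 < ∫ α in Ioo (0:ℝ) 1, μ α) (x : ℝ) :
    0 < ∫ α in Ioo (0:ℝ) 1, Real.exp (α * x) * Real.sin (π * α) * μ α := by
  have hs : ∀ α ∈ Ioo (0:ℝ) 1, 0 < Real.sin (π * α) := fun α hα =>
    Real.sin_pos_of_pos_of_lt_pi (mul_pos pi_pos hα.1) (mul_lt_of_lt_one_right pi_pos hα.2)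
  rw [setIntegral_pos_iff_support_of_nonneg_ae _ hint] at hpos
  · rw [setIntegral_pos_iff_support_of_nonneg_ae _ (integrableOn_exp_mul_sin hmeas hint x)]
    · convert hpos using 2
      ext α
      simp only [mem_inter_iff, Function.mem_support, and_congr_left_iff]
      intro hα
      simp [(hs α hα).ne']
    · refine (ae_restrict_iff' measurableSet_Ioo).2 (.of_forall fun α hα => ?_)
      have := hnn α (Ioo_subset_Icc_self hα)
      have := hs α hα
      simp only [Pi.zero_apply]
      positivity
  · exact (ae_restrict_iff' measurableSet_Ioo).2
      (.of_forall fun α hα => hnn α (Ioo_subset_Icc_self hα))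
end

section
variable {μ : ℝ → ℝ} {lam : ℝ}

lemma expSymbol_re (hmeas : Measurable μ) (hint : IntegrableOn μ (Ioo 0 1)) (w : ℂ) :
    (expSymbol μ w).re =
      ∫ α in Ioo (0:ℝ) 1, Real.exp (α * w.re) * Real.cos (α * w.im) * μ α := by
  rw [expSymbol, ← RCLike.re_eq_complex_re, ← integral_re (integrableOn_cexp_mul hmeas hint w)]
  refine integral_congr_ae (.of_forall fun α => ?_)
  simp [Complex.exp_re]

lemma expSymbol_im (hmeas : Measurable μ) (hint : IntegrableOn μ (Ioo 0 1)) (w : ℂ) :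
    (expSymbol μ w).im =
      ∫ α in Ioo (0:ℝ) 1, Real.exp (α * w.re) * Real.sin (α * w.im) * μ α := by
  rw [expSymbol, ← RCLike.im_eq_complex_im, ← integral_im (integrableOn_cexp_mul hmeas hint w)]
  refine integral_congr_ae (.of_forall fun α => ?_)
  simp [Complex.exp_im]

lemma Gfun_exp (hmeas : Measurable μ) (hint : IntegrableOn μ (Ioo 0 1)) (x : ℝ) :
    Gfun μ lam (Real.exp x) =
      -(((lam : ℂ) + expSymbol μ (x + π * Complex.I))⁻¹).im := by
  rw [Complex.inv_im, Complex.normSq_apply, Complex.add_re, Complex.add_im,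
    expSymbol_re hmeas hint, expSymbol_im hmeas hint, Gfun]
  simp [← Real.exp_mul, mul_comm, neg_div, sq]

lemma Gfun_nonneg (hnn : ∀ α ∈ Icc (0:ℝ) 1, 0 ≤ μ α) {r : ℝ} (hr : 0 ≤ r) :
    0 ≤ Gfun μ lam r := by
  refine div_nonneg (setIntegral_nonneg measurableSet_Ioo fun α hα => ?_) (by positivity)
  refine mul_nonneg (mul_nonneg (Real.rpow_nonneg hr _) ?_) (hnn α (Ioo_subset_Icc_self hα))
  exact Real.sin_nonneg_of_nonneg_of_le_pi (mul_nonneg pi_pos.le hα.1.le)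
    (mul_le_of_le_one_right pi_pos.le hα.2.le)

open Filter Topology in
/-- Cauchy's theorem for `w ↦ 1 / (λ + ∫₀¹ e^{αw} μ(α) dα)` on the rectangles
`[-x, x] × [0, π]` bounds the integrals of `x ↦ G(eˣ)` over `[-x, x]`. -/
lemma integrable_Gfun_exp (hlam : 0 < lam) (hmeas : Measurable μ)
    (hnn : ∀ α ∈ Icc (0:ℝ) 1, 0 ≤ μ α) (hint : IntegrableOn μ (Ioo 0 1))
    (hpos : 0 < ∫ α in Ioo (0:ℝ) 1, μ α) :
    Integrable fun x => Gfun μ lam (Real.exp x) := by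
  set H : ℂ → ℂ := fun w => ((lam : ℂ) + expSymbol μ w)⁻¹ with hH
  have hne : ∀ w : ℂ, w.im ∈ Icc 0 π → (lam : ℂ) + expSymbol μ w ≠ 0 := fun w hw =>
    norm_pos_iff.1 ((integral_exp_mul_sin_pos hmeas hnn hint hpos w.re).trans_le
      (integral_exp_mul_sin_le_norm hlam hmeas hnn hint hw))
  have hdiff : ∀ w : ℂ, w.im ∈ Icc 0 π → DifferentiableAt ℂ H w := fun w hw =>
    ((differentiable_expSymbol hmeas hint w).const_add _).inv (hne w hw)
  have hline : Continuous fun x : ℝ => H (x + π * Complex.I) :=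
    continuous_iff_continuousAt.2 fun x =>
      ContinuousAt.comp (f := fun x : ℝ => (x + π * Complex.I : ℂ))
        (hdiff _ (by simp [pi_pos.le])).continuousAt (by fun_prop)
  have hGcont : Continuous fun x => Gfun μ lam (Real.exp x) := by
    simp_rw [Gfun_exp hmeas hint]
    exact (Complex.continuous_im.comp hline).neg
  set s := ∫ α in Ioo (0:ℝ) 1, Real.exp (α * 0) * Real.sin (π * α) * μ α with hs
  have hs0 : 0 < s := integral_exp_mul_sin_pos hmeas hnn hint hpos 0
  have hright : ∀ w : ℂ, w.im ∈ Icc 0 π → 0 ≤ w.re → ‖H w‖ ≤ s⁻¹ := fun w hw hre => by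
    rw [hH, norm_inv]
    refine inv_anti₀ hs0 (le_trans ?_ (integral_exp_mul_sin_le_norm hlam hmeas hnn hint hw))
    refine setIntegral_mono_on (integrableOn_exp_mul_sin hmeas hint _)
      (integrableOn_exp_mul_sin hmeas hint _) measurableSet_Ioo fun α hα => ?_
    have h1 := hnn α (Ioo_subset_Icc_self hα)
    have h2 : 0 ≤ Real.sin (π * α) :=
      Real.sin_nonneg_of_nonneg_of_le_pi (mul_nonneg pi_pos.le hα.1.le)
        (mul_le_of_le_one_right pi_pos.le hα.2.le)
    have h3 := hα.1.le
    gcongr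
  have hleft : ∀ᶠ x : ℝ in atBot, ∀ w : ℂ, w.re = x → ‖H w‖ ≤ (lam / 2)⁻¹ := by
    filter_upwards [(tendsto_integral_exp_mul_atBot hmeas hint).eventually_le_const
      (half_pos hlam)] with x hx w hw
    rw [hH, norm_inv]
    refine inv_anti₀ (half_pos hlam) ?_
    have h1 := (norm_expSymbol_le hnn w).trans (hw ▸ hx)
    have h2 := norm_sub_le_norm_add (lam : ℂ) (expSymbol μ w)
    rw [Complex.norm_real, Real.norm_of_nonneg hlam.le] at h2
    linarith
  refine integrable_of_intervalIntegral_norm_bounded (a := fun x : ℝ => -x) (b := id)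
    (l := atTop) (s⁻¹ * π + (lam / 2)⁻¹ * π)
    (fun x => (hGcont.integrableOn_Icc).mono_set Ioc_subset_Icc_self)
    tendsto_neg_atTop_atBot tendsto_id ?_
  filter_upwards [tendsto_neg_atTop_atBot.eventually hleft, eventually_ge_atTop 0] with n hn hn0
  have hC := Complex.integral_boundary_rect_eq_zero_of_differentiableOn H (⟨-n, 0⟩ : ℂ) ⟨n, π⟩
    fun w hw => (hdiff w (by
      have := hw.2; rwa [mem_preimage, uIcc_of_le pi_pos.le] at this)).differentiableWithinAt
  simp only at hC
  have hreal : (∫ x : ℝ in -n..n, H (x + (0 : ℝ) * Complex.I)).im = 0 := by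
    have h0 : ∀ x : ℝ, H (x + (0 : ℝ) * Complex.I) =
        ((H (x + (0 : ℝ) * Complex.I)).re : ℂ) := fun x => by
      refine Complex.ext (by simp) ?_
      simp only [hH, Complex.inv_im, Complex.add_im, expSymbol_im hmeas hint]
      simp
    rw [intervalIntegral.integral_congr fun x _ => h0 x,
      intervalIntegral.integral_ofReal, Complex.ofReal_im]
  have htop : (∫ x : ℝ in -n..n, H (x + π * Complex.I)).im =
      -∫ x in -n..n, ‖Gfun μ lam (Real.exp x)‖ := by
    have h := intervalIntegral.intervalIntegral_im (μ := volume) (hline.intervalIntegrable (-n) n)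
    simp only [RCLike.im_eq_complex_im] at h
    rw [← h, ← intervalIntegral.integral_neg]
    refine intervalIntegral.integral_congr fun x _ => ?_
    rw [Real.norm_of_nonneg (Gfun_nonneg hnn (Real.exp_nonneg x)), Gfun_exp hmeas hint, neg_neg]
  have hA : ‖∫ y : ℝ in (0:ℝ)..π, H ((n : ℝ) + y * Complex.I)‖ ≤ s⁻¹ * π := by
    have h := intervalIntegral.norm_integral_le_of_norm_le_const (a := 0) (b := π) (C := s⁻¹)
      (f := fun y : ℝ => H ((n : ℝ) + y * Complex.I)) fun y hy => by
        rw [uIoc_of_le pi_pos.le] at hy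
        exact hright _ (by simpa using ⟨hy.1.le, hy.2⟩) (by simpa using hn0)
    simpa [abs_of_pos pi_pos] using h
  have hB : ‖∫ y : ℝ in (0:ℝ)..π, H ((-n : ℝ) + y * Complex.I)‖ ≤ (lam / 2)⁻¹ * π := by
    have h := intervalIntegral.norm_integral_le_of_norm_le_const (a := 0) (b := π)
      (C := (lam / 2)⁻¹) (f := fun y : ℝ => H ((-n : ℝ) + y * Complex.I)) fun y hy =>
        hn _ (by simp)
    rwa [sub_zero, abs_of_pos pi_pos] at h
  have him := congrArg Complex.im hC
  simp only [Complex.add_im, Complex.sub_im, smul_eq_mul, Complex.I_mul_im, Complex.zero_im] at him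
  rw [hreal, htop] at him
  have h1 := (abs_le.1 (Complex.abs_re_le_norm
    (∫ y : ℝ in (0:ℝ)..π, H ((n : ℝ) + y * Complex.I)))).1
  have h2 := Complex.re_le_norm (∫ y : ℝ in (0:ℝ)..π, H ((-n : ℝ) + y * Complex.I))
  simp only [id]
  linarith

lemma integrableOn_Gfun_div (hlam : 0 < lam) (hmeas : Measurable μ)
    (hnn : ∀ α ∈ Icc (0:ℝ) 1, 0 ≤ μ α) (hint : IntegrableOn μ (Ioo 0 1))
    (hpos : 0 < ∫ α in Ioo (0:ℝ) 1, μ α) :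
    IntegrableOn (fun r => Gfun μ lam r / r) (Ioi 0) := by
  rw [← Real.range_exp, ← image_univ, integrableOn_image_iff_integrableOn_abs_deriv_smul
    MeasurableSet.univ (fun x _ => (Real.hasDerivAt_exp x).hasDerivWithinAt)
    Real.exp_injective.injOn, integrableOn_univ]
  refine (integrable_Gfun_exp hlam hmeas hnn hint hpos).congr (.of_forall fun x => ?_)
  simp only [Real.abs_exp, smul_eq_mul]
  field_simp
end

section Laplace
open Filter Topology
variable {g : ℝ → ℝ}

lemma integrableOn_exp_neg_mul (hg : IntegrableOn g (Ioi 0)) {t : ℝ} (ht : 0 ≤ t) :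
    IntegrableOn (fun r => Real.exp (-r * t) * g r) (Ioi 0) := by
  refine Integrable.bdd_mul (c := 1) hg (by fun_prop) ?_
  refine (ae_restrict_iff' measurableSet_Ioi).2 (.of_forall fun r hr => ?_)
  rw [Real.norm_eq_abs, Real.abs_exp, Real.exp_le_one_iff]
  nlinarith [mem_Ioi.1 hr]

lemma norm_exp_neg_mul_le {t : ℝ} (ht : 0 ≤ t) :
    ∀ᵐ r ∂volume.restrict (Ioi (0:ℝ)), ‖Real.exp (-r * t) * g r‖ ≤ ‖g r‖ := by
  refine (ae_restrict_iff' measurableSet_Ioi).2 (.of_forall fun r hr => ?_)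
  rw [norm_mul, Real.norm_eq_abs, Real.abs_exp]
  exact mul_le_of_le_one_left (norm_nonneg _)
    (Real.exp_le_one_iff.2 (by nlinarith [mem_Ioi.1 hr]))

lemma continuousOn_integral_exp_neg_mul (hg : IntegrableOn g (Ioi 0)) :
    ContinuousOn (fun t => ∫ r in Ioi (0:ℝ), Real.exp (-r * t) * g r) (Ici 0) :=
  continuousOn_of_dominated (fun _ ht => (integrableOn_exp_neg_mul hg ht).aestronglyMeasurable)
    (fun _ ht => norm_exp_neg_mul_le ht) hg.norm (.of_forall fun r => by fun_prop)

lemma tendsto_integral_exp_neg_mul_atTop (hg : IntegrableOn g (Ioi 0)) :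
    Tendsto (fun t => ∫ r in Ioi (0:ℝ), Real.exp (-r * t) * g r) atTop (𝓝 0) := by
  suffices h : Tendsto (fun t => ∫ r in Ioi (0:ℝ), Real.exp (-r * t) * g r) atTop
      (𝓝 (∫ r in Ioi (0:ℝ), (0:ℝ))) by simpa using h
  refine tendsto_integral_filter_of_dominated_convergence (fun r => ‖g r‖) ?_ ?_ hg.norm ?_
  · filter_upwards [eventually_ge_atTop 0] with t ht
    exact (integrableOn_exp_neg_mul hg ht).aestronglyMeasurable
  · filter_upwards [eventually_ge_atTop 0] with t ht using norm_exp_neg_mul_le ht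
  · refine (ae_restrict_iff' measurableSet_Ioi).2 (.of_forall fun r hr => ?_)
    simpa using (Real.tendsto_exp_atBot.comp
      (tendsto_id.const_mul_atTop_of_neg (neg_lt_zero.2 (mem_Ioi.1 hr)))).mul_const (g r)

/-- The Laplace transform of a nonnegative integrable function is smooth on `(0, ∞)`. -/
lemma contDiffOn_and_hasDerivAt_integral_exp_neg_mul (hg : IntegrableOn g (Ioi 0))
    (hg0 : ∀ r ∈ Ioi (0:ℝ), 0 ≤ g r) :
    ContDiffOn ℝ (⊤ : ℕ∞) (fun t => ∫ r in Ioi (0:ℝ), Real.exp (-r * t) * g r) (Ioi 0) ∧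
    ∀ t > 0, HasDerivAt (fun t => ∫ r in Ioi (0:ℝ), Real.exp (-r * t) * g r)
      (-∫ r in Ioi (0:ℝ), Real.exp (-r * t) * (r * g r)) t := by
  set m : Measure ℝ := (volume.restrict (Ioi (0:ℝ))).withDensity fun r => ENNReal.ofReal (g r)
  have hgm : AEMeasurable (fun r => ENNReal.ofReal (g r)) (volume.restrict (Ioi (0:ℝ))) :=
    hg.aemeasurable.ennreal_ofReal
  have hm : ∀ f : ℝ → ℝ, ∫ r, f r ∂m = ∫ r in Ioi (0:ℝ), f r * g r := fun f => by
    rw [integral_withDensity_eq_integral_toReal_smul₀ hgm (by simp)]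
    refine setIntegral_congr_fun measurableSet_Ioi fun r hr => ?_
    simp [ENNReal.toReal_ofReal (hg0 r hr), mul_comm]
  have hmgf : (fun t => ∫ r in Ioi (0:ℝ), Real.exp (-r * t) * g r) =
      ProbabilityTheory.mgf (fun r => -r) m := by
    ext t
    rw [ProbabilityTheory.mgf, hm]
    simp only [mul_comm]
  have hsub : Ioi (0:ℝ) ⊆ interior (ProbabilityTheory.integrableExpSet (fun r => -r) m) := by
    refine interior_maximal (fun t ht => ?_) isOpen_Ioi
    refine (integrable_withDensity_iff_integrable_smul₀' hgm (by simp)).2 ?_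
    refine (integrableOn_exp_neg_mul hg (le_of_lt ht)).congr_fun (fun r hr => ?_) measurableSet_Ioi
    simp [ENNReal.toReal_ofReal (hg0 r hr), mul_comm]
  rw [hmgf]
  refine ⟨(ProbabilityTheory.analyticOnNhd_mgf.mono hsub).contDiffOn (uniqueDiffOn_Ioi 0),
    fun t ht => ?_⟩
  convert ProbabilityTheory.hasDerivAt_mgf (hsub ht) using 1
  rw [hm, ← integral_neg]
  refine integral_congr_ae (.of_forall fun r => ?_)
  simp only [mul_comm t]
  ring
end Laplace

/-- under (aa) only, the function `v` from (postacv) is continuous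
on `[0,∞)`, smooth on `(0,∞)` with
`v'(t) = -v₀ (λ/π) ∫₀^∞ e^{-rt} G(r) dr`, and `∫₀^∞ |v'| = |v₀| (λ/π) ∫₀^∞ G(r)/r dr < ∞`;
in particular `v` is absolutely continuous on `[0,∞)`. -/
theorem v_absolutely_continuous (μ : ℝ → ℝ) (lam v₀ : ℝ) (hlam : 0 < lam)
    (hmeas : Measurable μ)
    (hnn : ∀ α ∈ Icc (0:ℝ) 1, 0 ≤ μ α)
    (hint : IntegrableOn μ (Ioo 0 1))
    (hpos : 0 < ∫ α in Ioo (0:ℝ) 1, μ α) :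
    ContinuousOn (vfun μ lam v₀) (Ici 0) ∧
    ContDiffOn ℝ (⊤ : ℕ∞) (vfun μ lam v₀) (Ioi 0) ∧
    (∀ t > 0, HasDerivAt (vfun μ lam v₀)
      (-(v₀ * (lam / π) * ∫ r in Ioi (0:ℝ), Real.exp (-r * t) * Gfun μ lam r)) t) ∧
    IntegrableOn (fun r => Gfun μ lam r / r) (Ioi 0) ∧
    IntegrableOn (fun t => deriv (vfun μ lam v₀) t) (Ioi 0) ∧
    ((∫ t in Ioi (0:ℝ), |deriv (vfun μ lam v₀) t|) =
      |v₀| * (lam / π) * ∫ r in Ioi (0:ℝ), Gfun μ lam r / r) ∧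
    (∀ t ∈ Ici (0:ℝ),
      vfun μ lam v₀ t = vfun μ lam v₀ 0 + ∫ s in (0:ℝ)..t, deriv (vfun μ lam v₀) s) := by
  set g : ℝ → ℝ := fun r => Gfun μ lam r / r with hg
  set u : ℝ → ℝ := fun t => ∫ r in Ioi (0:ℝ), Real.exp (-r * t) * g r with hu
  set c : ℝ := v₀ * (lam / π) with hc
  have hgi : IntegrableOn g (Ioi 0) := integrableOn_Gfun_div hlam hmeas hnn hint hpos
  have hg0 : ∀ r ∈ Ioi (0:ℝ), 0 ≤ g r := fun r hr =>
    div_nonneg (Gfun_nonneg hnn (le_of_lt hr)) (le_of_lt hr)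
  have hv : vfun μ lam v₀ = fun t => c * u t := by
    ext t
    simp only [vfun, hu, hg, div_mul_eq_mul_div, mul_div_assoc]
    rfl
  obtain ⟨hsmooth, hderiv⟩ := contDiffOn_and_hasDerivAt_integral_exp_neg_mul hgi hg0
  have hucont : ContinuousOn u (Ici 0) := continuousOn_integral_exp_neg_mul hgi
  have hvcont : ContinuousOn (vfun μ lam v₀) (Ici 0) := hv ▸ hucont.const_smul c
  set D : ℝ → ℝ := fun t => -∫ r in Ioi (0:ℝ), Real.exp (-r * t) * (r * g r) with hD
  have hD0 : ∀ t ∈ Ioi (0:ℝ), D t ≤ 0 := fun t _ =>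
    neg_nonpos.2 (setIntegral_nonneg measurableSet_Ioi fun r hr =>
      mul_nonneg (Real.exp_nonneg _) (mul_nonneg (le_of_lt hr) (hg0 r hr)))
  have hcont0 : ContinuousWithinAt u (Ici 0) 0 := hucont 0 self_mem_Ici
  have hlim := tendsto_integral_exp_neg_mul_atTop hgi
  have hDi : IntegrableOn D (Ioi 0) := integrableOn_Ioi_deriv_of_nonpos hcont0 hderiv hD0 hlim
  have hDint : ∫ t in Ioi (0:ℝ), D t = 0 - u 0 :=
    integral_Ioi_of_hasDerivAt_of_nonpos hcont0 hderiv hD0 hlim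
  have hvd : ∀ t > 0, HasDerivAt (vfun μ lam v₀) (c * D t) t := fun t ht =>
    hv ▸ (hderiv t ht).const_mul c
  have hdv : EqOn (fun t => c * D t) (deriv (vfun μ lam v₀)) (Ioi 0) := fun t ht =>
    (hvd t ht).deriv.symm
  have hdi : IntegrableOn (deriv (vfun μ lam v₀)) (Ioi 0) :=
    IntegrableOn.congr_fun (hDi.const_mul c) hdv measurableSet_Ioi
  refine ⟨hvcont, hv ▸ contDiffOn_const.mul hsmooth, fun t ht => ?_, hgi, hdi, ?_, fun t ht => ?_⟩
  · convert hvd t ht using 1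
    rw [hD, mul_neg]
    congr 2
    refine setIntegral_congr_fun measurableSet_Ioi fun r hr => ?_
    simp only [hg, mul_div_cancel₀ _ (ne_of_gt (mem_Ioi.1 hr))]
  · have habs : ∀ t ∈ Ioi (0:ℝ), |deriv (vfun μ lam v₀) t| = -|c| * D t := fun t ht => by
      rw [← hdv ht, abs_mul, abs_of_nonpos (hD0 t ht), mul_neg, neg_mul]
    rw [setIntegral_congr_fun measurableSet_Ioi habs, integral_const_mul, hDint, hc, abs_mul,
      abs_of_pos (div_pos hlam pi_pos)]
    simp [hu]
  · refine eq_add_of_sub_eq' (intervalIntegral.integral_eq_sub_of_hasDerivAt_of_le ht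
      (hvcont.mono Icc_subset_Ici_self) (fun s hs => (hvd s hs.1).differentiableAt.hasDerivAt)
      ?_).symm
    rw [intervalIntegrable_iff_integrableOn_Ioc_of_le ht]
    exact hdi.mono_set Ioc_subset_Ioi_self
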